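/- Let y and c be locally piecewise constant, let x be a queue trajectory for (y, c), let α be a transition point of x with 0 ≤ α < T, and suppose x has no transition point in the open interval (α, T). Then x(T) = max(∫_α^T (y(r) − c(r)) dr, 0). -/

import Mathlib

open MeasureTheory

/-- `f` is piecewise constant on the set `s`: there is a finite set `D` of breakpoints
such that `f` is constant between consecutive breakpoints (pieces are right-open). -/
def PwcOn (f : ℝ → ℝ) (s : Set ℝ) : Prop :=
  ∃ D : Finset ℝ, ∀ u ∈ s, ∀ v ∈ s, u ≤ v → (∀ d ∈ D, d ∉ Set.Ioc u v) → f u = f v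

/-- `f` is locally piecewise constant on `[0, ∞)`: piecewise constant on every compact
subinterval. -/
def LocPwc (f : ℝ → ℝ) : Prop :=
  ∀ a b : ℝ, PwcOn f (Set.Ici 0 ∩ Set.Icc a b)

/-- The net rate of change of the queue: `y − c` when the queue is positive, and
`max (y − c) 0` when the queue is empty. -/
noncomputable def qrate (y c x : ℝ → ℝ) (r : ℝ) : ℝ :=
  if 0 < x r then y r - c r else max (y r - c r) 0

/-- `x` is a queue trajectory for inflow `y` and capacity `c`: it is nonnegative on
`[0, ∞)` and satisfies `x t = x 0 + ∫_0^t qrate` for every `t ≥ 0`. -/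
def QueueTraj (y c x : ℝ → ℝ) : Prop :=
  (∀ t, 0 ≤ t → 0 ≤ x t) ∧
  ∀ t, 0 ≤ t → x t = x 0 + ∫ r in (0:ℝ)..t, qrate y c x r

/-- The outflow of the queue trajectory `x` for `(y, c)`: the capacity when the queue is
positive, and `min y c` when the queue is empty. -/
noncomputable def outflow (y c x : ℝ → ℝ) (t : ℝ) : ℝ :=
  if 0 < x t then c t else min (y t) (c t)

/-- `α` is a transition point of the queue trajectory `x`: `x α = 0` and `x` is strictly
positive on some interval `(α, α + ε]`. -/
def TransitionPt (x : ℝ → ℝ) (α : ℝ) : Prop :=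
  0 ≤ α ∧ x α = 0 ∧ ∃ ε > 0, ∀ t ∈ Set.Ioc α (α + ε), 0 < x t

open Set in
/-- A function that is constant between consecutive points of a finite set is interval
integrable. -/
theorem intervalIntegrable_of_const_between (f : ℝ → ℝ) (D : Finset ℝ) {a b : ℝ} (hab : a ≤ b)
    (h : ∀ u ∈ Ioo a b, ∀ v ∈ Ioo a b, u ≤ v → (∀ d ∈ D, d ∉ Ioc u v) → f u = f v) :
    IntervalIntegrable f volume a b := by
  induction D using Finset.induction_on generalizing a b with
  | empty =>
    refine (intervalIntegrable_const (c := f ((a + b) / 2))).congr_uIoo ?_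
    intro t ht
    rw [uIoo_of_le hab] at ht
    have hm : (a + b) / 2 ∈ Ioo a b := ⟨by linarith [ht.1, ht.2], by linarith [ht.1, ht.2]⟩
    rcases le_total ((a + b) / 2) t with hle | hle
    · exact h _ hm _ ht hle (by simp)
    · exact (h _ ht _ hm hle (by simp)).symm
  | insert d D _ ih =>
    by_cases hd : d ∈ Ioo a b
    · refine (ih hd.1.le ?_).trans (ih hd.2.le ?_)
      · intro u hu v hv huv hD
        refine h u ⟨hu.1, hu.2.trans hd.2⟩ v ⟨hv.1, hv.2.trans hd.2⟩ huv ?_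
        rw [Finset.forall_mem_insert]
        exact ⟨fun hmem => absurd hmem.2 (not_le.2 hv.2), hD⟩
      · intro u hu v hv huv hD
        refine h u ⟨hd.1.trans hu.1, hu.2⟩ v ⟨hd.1.trans hv.1, hv.2⟩ huv ?_
        rw [Finset.forall_mem_insert]
        exact ⟨fun hmem => absurd hmem.1 (not_lt.2 hu.1.le), hD⟩
    · refine ih hab fun u hu v hv huv hD => h u hu v hv huv ?_
      rw [Finset.forall_mem_insert]
      exact ⟨fun hmem => hd ⟨hu.1.trans hmem.1, hmem.2.trans_lt hv.2⟩, hD⟩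

open Set in
theorem LocPwc.intervalIntegrable {f : ℝ → ℝ} (hf : LocPwc f) {a b : ℝ} (ha : 0 ≤ a)
    (hab : a ≤ b) : IntervalIntegrable f volume a b := by
  obtain ⟨D, hD⟩ := hf a b
  exact intervalIntegrable_of_const_between f D hab fun u hu v hv =>
    hD u ⟨ha.trans hu.1.le, Ioo_subset_Icc_self hu⟩ v ⟨ha.trans hv.1.le, Ioo_subset_Icc_self hv⟩

theorem sub_le_qrate (y c x : ℝ → ℝ) (r : ℝ) : y r - c r ≤ qrate y c x r := by
  unfold qrate
  split_ifs
  · exact le_rfl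
  · exact le_max_left _ _

theorem abs_qrate_le (y c x : ℝ → ℝ) (r : ℝ) : |qrate y c x r| ≤ |y r - c r| := by
  unfold qrate
  split_ifs
  · exact le_rfl
  · rw [abs_of_nonneg (le_max_right _ _)]
    exact max_le (le_abs_self _) (abs_nonneg _)

theorem aestronglyMeasurable_qrate {y c x : ℝ → ℝ} {μ : Measure ℝ}
    (hg : AEStronglyMeasurable (fun r => y r - c r) μ) (hx : AEStronglyMeasurable x μ) :
    AEStronglyMeasurable (qrate y c x) μ := by
  have hφ : Measurable fun p : ℝ × ℝ => if 0 < p.2 then p.1 else max p.1 0 :=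
    Measurable.ite (measurableSet_lt measurable_const measurable_snd) measurable_fst
      (measurable_fst.max measurable_const)
  exact (hφ.comp_aemeasurable (hg.aemeasurable.prodMk hx.aemeasurable)).aestronglyMeasurable

open Set in
theorem QueueTraj.continuousOn_Icc {y c x : ℝ → ℝ} (hx : QueueTraj y c x) {t : ℝ} (ht : 0 ≤ t)
    (hq : IntervalIntegrable (qrate y c x) volume 0 t) : ContinuousOn x (Icc 0 t) := by
  have h : ContinuousOn (fun u => x 0 + ∫ r in (0 : ℝ)..u, qrate y c x r) (Icc 0 t) := by
    refine continuousOn_const.add ?_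
    have := intervalIntegral.continuousOn_primitive_interval' hq left_mem_uIcc
    rwa [uIcc_of_le ht] at this
  exact h.congr fun u hu => hx.2 u hu.1

open Set Topology in
/-- The rate of a queue trajectory is integrable: past the first time where integrability could
fail, the trajectory would be constant, hence measurable. -/
theorem QueueTraj.intervalIntegrable_qrate {y c x : ℝ → ℝ} (hx : QueueTraj y c x)
    (hg : ∀ t, 0 ≤ t → IntervalIntegrable (fun r => y r - c r) volume 0 t) {t : ℝ} (ht : 0 ≤ t) :
    IntervalIntegrable (qrate y c x) volume 0 t := by
  set S : Set ℝ := {u | 0 ≤ u ∧ IntervalIntegrable (qrate y c x) volume 0 u}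
  have hSsub : ∀ u ∈ S, Icc 0 u ⊆ S := fun u hu v hv =>
    ⟨hv.1, hu.2.mono_set (uIcc_subset_uIcc_left (by rw [uIcc_of_le hu.1]; exact hv))⟩
  have hSm : MeasurableSet S :=
    (OrdConnected.mk fun u hu v hv w hw => hSsub v hv ⟨hu.1.trans hw.1, hw.2⟩).measurableSet
  have hcont : ContinuousOn x S := by
    intro u hu
    by_cases h : ∃ v ∈ S, u < v
    · obtain ⟨v, hv, huv⟩ := h
      refine (hx.continuousOn_Icc hv.1 hv.2 u ⟨hu.1, huv.le⟩).mono_of_mem_nhdsWithin ?_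
      filter_upwards [self_mem_nhdsWithin, mem_nhdsWithin_of_mem_nhds (Iio_mem_nhds huv)]
        with w hw hwv
      exact ⟨hw.1, le_of_lt hwv⟩
    · push Not at h
      exact (hx.continuousOn_Icc hu.1 hu.2 u ⟨hu.1, le_rfl⟩).mono fun w hw => ⟨hw.1, h w hw⟩
  have hconst : AEStronglyMeasurable x (volume.restrict (Ici 0 \ S)) := by
    refine (continuousOn_const (c := x 0)).congr (fun u hu => ?_) |>.aestronglyMeasurable
      (measurableSet_Ici.diff hSm)
    rw [hx.2 u hu.1, intervalIntegral.integral_undef fun h => hu.2 ⟨hu.1, h⟩, add_zero]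
  have hmeas : AEStronglyMeasurable x (volume.restrict (Ioc 0 t)) := by
    refine (aestronglyMeasurable_union_iff.2
      ⟨hcont.aestronglyMeasurable hSm, hconst⟩).mono_set fun u hu => ?_
    by_cases h : u ∈ S
    · exact Or.inl h
    · exact Or.inr ⟨hu.1.le, h⟩
  have hgt := (intervalIntegrable_iff_integrableOn_Ioc_of_le ht).1 (hg t ht)
  rw [intervalIntegrable_iff_integrableOn_Ioc_of_le ht]
  exact Integrable.mono hgt (aestronglyMeasurable_qrate hgt.aestronglyMeasurable hmeas)
    (.of_forall fun r => abs_qrate_le y c x r)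

open Set in
/-- If a continuous function vanishes at `a` and is positive at `b > a`, then its last zero in
`[a, b]` is followed by an interval of positivity. -/
theorem exists_last_zero {x : ℝ → ℝ} {a b : ℝ} (hab : a < b) (hx : ContinuousOn x (Icc a b))
    (hnn : ∀ t ∈ Icc a b, 0 ≤ x t) (ha : x a = 0) (hb : 0 < x b) :
    ∃ β ∈ Ico a b, x β = 0 ∧ ∀ t ∈ Ioc β b, 0 < x t := by
  have hZ : IsCompact (Icc a b ∩ x ⁻¹' {0}) :=
    isCompact_Icc.of_isClosed_subset (hx.preimage_isClosed_of_isClosed isClosed_Icc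
      isClosed_singleton) inter_subset_left
  obtain ⟨β, ⟨hβ, hβ0⟩, hmax⟩ := hZ.exists_isGreatest ⟨a, left_mem_Icc.2 hab.le, ha⟩
  have hβ0 : x β = 0 := hβ0
  refine ⟨β, ⟨hβ.1, lt_of_le_of_ne hβ.2 ?_⟩, hβ0, fun t ht => ?_⟩
  · rintro rfl
    exact hb.ne' hβ0
  · have htI : t ∈ Icc a b := ⟨hβ.1.trans ht.1.le, ht.2⟩
    exact lt_of_le_of_ne (hnn t htI) fun h => absurd (hmax ⟨htI, h.symm⟩) (not_le.2 ht.1)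

/-- If `α` is the last transition point of the queue trajectory `x` before time `T`
(there is no transition point in `(α, T)`), then
`x T = max (∫_α^T (y − c)) 0`. -/
theorem queue_value_from_last_transition (y c x : ℝ → ℝ) (α T : ℝ)
    (hy_nn : ∀ t, 0 ≤ t → 0 ≤ y t) (hc_nn : ∀ t, 0 ≤ t → 0 ≤ c t)
    (hy_pwc : LocPwc y) (hc_pwc : LocPwc c)
    (hx : QueueTraj y c x)
    (htp : TransitionPt x α) (hαT : α < T)
    (hlast : ∀ β ∈ Set.Ioo α T, ¬ TransitionPt x β) :
    x T = max (∫ r in α..T, (y r - c r)) 0 := by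
  have hg : ∀ {a b : ℝ}, 0 ≤ a → a ≤ b → IntervalIntegrable (fun r => y r - c r) volume a b :=
    fun ha hab => (hy_pwc.intervalIntegrable ha hab).sub (hc_pwc.intervalIntegrable ha hab)
  obtain ⟨hα, hxα, -⟩ := htp
  have hT : 0 ≤ T := hα.trans hαT.le
  have hq : ∀ {t : ℝ}, 0 ≤ t → IntervalIntegrable (qrate y c x) volume 0 t :=
    fun ht => hx.intervalIntegrable_qrate (fun _ hs => hg le_rfl hs) ht
  have hxT : x T = ∫ r in α..T, qrate y c x r := by
    rw [← intervalIntegral.integral_interval_sub_left (hq hT) (hq hα)]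
    linarith [hx.2 T hT, hx.2 α hα]
  have hle : ∫ r in α..T, (y r - c r) ≤ x T := by
    rw [hxT]
    exact intervalIntegral.integral_mono hαT.le (hg hα hαT.le) ((hq hα).symm.trans (hq hT))
      fun r => sub_le_qrate y c x r
  rcases (hx.1 T hT).eq_or_lt with h0 | hpos
  · rw [max_eq_right (hle.trans h0.ge), h0]
  · obtain ⟨β, hβ, hβ0, hβpos⟩ := exists_last_zero hαT
      ((hx.continuousOn_Icc hT (hq hT)).mono (Set.Icc_subset_Icc_left hα))
      (fun t ht => hx.1 t (hα.trans ht.1)) hxα hpos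
    obtain rfl : α = β := by
      by_contra hne
      refine hlast β ⟨lt_of_le_of_ne hβ.1 hne, hβ.2⟩
        ⟨hα.trans hβ.1, hβ0, T - β, sub_pos.2 hβ.2, ?_⟩
      rwa [add_sub_cancel]
    have heq : x T = ∫ r in α..T, (y r - c r) := by
      rw [hxT]
      refine intervalIntegral.integral_congr_uIoo fun r hr => ?_
      rw [Set.uIoo_of_le hαT.le] at hr
      exact if_pos (hβpos r ⟨hr.1, hr.2.le⟩)
    rw [← heq, max_eq_left hpos.le]
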